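/- For all sufficiently large n and every stable tree T of the tree connection game with n agents, the Fairness Ratio satisfies FR(T) ≥ n · 2^{−2·√(2·log₂ n)}. -/

import Mathlib

open Function
open scoped ENNReal Classical

noncomputable section

namespace TCG

variable {n : ℕ}

/-- In-degree of node `v` in the network induced by profile `s` with root `r`:
the number of activated edges `(u, v)` with `u` an agent (a non-root node). -/
def indeg (r : Fin (n + 1)) (s : Fin (n + 1) → Fin (n + 1)) (v : Fin (n + 1)) : ℕ :=
  Nat.card {u : Fin (n + 1) | u ≠ r ∧ s u = v}

/-- `|T(u)|`: the number of nodes having a directed path to `u` (including `u` itself). -/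
def subtreeSize (s : Fin (n + 1) → Fin (n + 1)) (u : Fin (n + 1)) : ℕ :=
  Nat.card {w : Fin (n + 1) | ∃ k, s^[k] w = u}

/-- Cost of the agent at node `v` with respect to the root `r`:
the sum, over the edges `(u, u')` of the unique directed path from `v` to `r`,
of `indeg(u') / |T(u)|`; the cost is `∞` if no such path exists. -/
def cost (r : Fin (n + 1)) (s : Fin (n + 1) → Fin (n + 1)) (v : Fin (n + 1)) : ℝ≥0∞ :=
  if h : ∃ k, s^[k] v = r then
    ∑ k ∈ Finset.range (Nat.find h),
      (indeg r s (s^[k + 1] v) : ℝ≥0∞) / (subtreeSize s (s^[k] v) : ℝ≥0∞)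
  else ⊤

/-- A valid strategy profile: the root is absorbing (a formal convention encoding that the
root activates no edge), and every agent chooses a node different from herself. -/
def ValidProfile (r : Fin (n + 1)) (s : Fin (n + 1) → Fin (n + 1)) : Prop :=
  s r = r ∧ ∀ v, v ≠ r → s v ≠ v

/-- Pure Nash equilibrium (the induced network is *stable*): no agent can strictly
decrease her cost by unilaterally switching her activated edge to another node. -/
def IsStable (r : Fin (n + 1)) (s : Fin (n + 1) → Fin (n + 1)) : Prop :=
  ValidProfile r s ∧
    ∀ v, v ≠ r → ∀ w, w ≠ v → cost r s v ≤ cost r (Function.update s v w) v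

/-- Social cost: the sum of the costs of all agents (the non-root nodes). -/
def SC (s : Fin (n + 1) → Fin (n + 1)) : ℝ≥0∞ :=
  ∑ v ∈ Finset.univ.erase (0 : Fin (n + 1)), cost 0 s v

/-- Height of the induced network: the maximum length of a (leaf-to-)root path,
i.e. the least `k` such that every node arrives at the root after `k` steps. -/
def height (s : Fin (n + 1) → Fin (n + 1)) : ℕ :=
  sInf {k | ∀ v, s^[k] v = 0}

/-- Fairness Ratio: maximum agent cost divided by minimum agent cost. -/
def FR (s : Fin (n + 1) → Fin (n + 1)) : ℝ≥0∞ :=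
  (⨆ (v : Fin (n + 1)) (_ : v ≠ 0), cost 0 s v) /
    (⨅ (v : Fin (n + 1)) (_ : v ≠ 0), cost 0 s v)

variable {s : Fin (n + 1) → Fin (n + 1)}

section Tree

lemma cost_zero (s : Fin (n + 1) → Fin (n + 1)) : cost 0 s 0 = 0 := by
  have h : ∃ k, s^[k] (0 : Fin (n + 1)) = 0 := ⟨0, rfl⟩
  have h0 : Nat.find h = 0 := (Nat.find_eq_zero h).2 rfl
  rw [cost, dif_pos h, h0, Finset.sum_range_zero]

lemma cost_eq_add {v : Fin (n + 1)} (hv : v ≠ 0) (h : ∃ k, s^[k] (s v) = 0) :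
    cost 0 s v = (indeg 0 s (s v) : ℝ≥0∞) / (subtreeSize s v : ℝ≥0∞) + cost 0 s (s v) := by
  have h' : ∃ k, s^[k] v = 0 := by
    obtain ⟨k, hk⟩ := h
    exact ⟨k + 1, hk⟩
  have hf : Nat.find h' = Nat.find h + 1 := Nat.find_comp_succ h' h hv
  rw [cost, dif_pos h', hf, Finset.sum_range_succ', cost, dif_pos h, add_comm]
  rfl

lemma subtreeSize_eq_card (s : Fin (n + 1) → Fin (n + 1)) (u : Fin (n + 1)) :
    subtreeSize s u = (Finset.univ.filter fun w => ∃ k, s^[k] w = u).card := by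
  rw [subtreeSize]
  exact Nat.subtype_card _ (by simp)

lemma indeg_eq_card (s : Fin (n + 1) → Fin (n + 1)) (v : Fin (n + 1)) :
    indeg 0 s v = (Finset.univ.filter fun u => u ≠ 0 ∧ s u = v).card := by
  rw [indeg]
  exact Nat.subtype_card _ (by simp)

lemma subtreeSize_pos (s : Fin (n + 1) → Fin (n + 1)) (u : Fin (n + 1)) :
    0 < subtreeSize s u := by
  rw [subtreeSize_eq_card]
  exact Finset.card_pos.2 ⟨u, by simpa using ⟨0, rfl⟩⟩

lemma cost_ne_top {v : Fin (n + 1)} (h : ∃ k, s^[k] v = 0) : cost 0 s v ≠ ⊤ := by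
  rw [cost, dif_pos h]
  refine (ENNReal.sum_lt_top.2 fun k _ => ENNReal.div_lt_top (ENNReal.natCast_ne_top _) ?_).ne
  exact_mod_cast (subtreeSize_pos s _).ne'

lemma iterate_zero (h0 : s 0 = 0) (k : ℕ) : s^[k] (0 : Fin (n + 1)) = 0 :=
  iterate_fixed h0 k

lemma eq_zero_of_cycle (h0 : s 0 = 0) (hr : ∀ v, ∃ k, s^[k] v = 0) {u : Fin (n + 1)} {j : ℕ}
    (h : s^[j] (s u) = u) : u = 0 := by
  obtain ⟨k, hk⟩ := hr u
  have hp : s^[(j + 1) * k] u = u := by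
    rw [iterate_mul]
    exact iterate_fixed (f := s^[j + 1]) h k
  rw [show (j + 1) * k = j * k + k by ring, iterate_add_apply, hk, iterate_zero h0] at hp
  exact hp.symm

lemma siblings_not_both_reached (h0 : s 0 = 0) (hr : ∀ v, ∃ k, s^[k] v = 0)
    {u w z : Fin (n + 1)} (hu : u ≠ 0) (hw : w ≠ 0) (huw : u ≠ w) (hs : s u = s w)
    (hzu : ∃ k, s^[k] z = u) (hzw : ∃ k, s^[k] z = w) : False := by
  obtain ⟨a, ha⟩ := hzu
  obtain ⟨b, hb⟩ := hzw
  rcases lt_trichotomy a b with h | h | h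
  · obtain ⟨c, rfl⟩ := Nat.exists_eq_add_of_lt h
    rw [show a + c + 1 = (c + 1) + a by ring, iterate_add_apply, ha, iterate_succ_apply, hs] at hb
    exact hw (eq_zero_of_cycle h0 hr hb)
  · subst h
    exact huw (ha.symm.trans hb)
  · obtain ⟨c, rfl⟩ := Nat.exists_eq_add_of_lt h
    rw [show b + c + 1 = (c + 1) + b by ring, iterate_add_apply, hb, iterate_succ_apply, ← hs] at ha
    exact hu (eq_zero_of_cycle h0 hr ha)

lemma sum_subtreeSize_le (h0 : s 0 = 0) (hr : ∀ v, ∃ k, s^[k] v = 0) (v : Fin (n + 1))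
    (A : Finset (Fin (n + 1))) (hA : ∀ u ∈ A, u ≠ 0 ∧ s u = v) :
    ∑ u ∈ A, subtreeSize s u ≤ subtreeSize s v := by
  simp only [subtreeSize_eq_card]
  rw [← Finset.card_biUnion]
  · refine Finset.card_le_card fun z hz => ?_
    simp only [Finset.mem_biUnion, Finset.mem_filter, Finset.mem_univ, true_and] at hz ⊢
    obtain ⟨u, hu, k, hk⟩ := hz
    exact ⟨k + 1, by rw [iterate_succ_apply', hk, (hA u hu).2]⟩
  · intro u hu w hw huw
    refine Finset.disjoint_left.2 fun z hz hz' => ?_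
    simp only [Finset.mem_filter, Finset.mem_univ, true_and] at hz hz'
    exact siblings_not_both_reached h0 hr (hA u hu).1 (hA w hw).1 huw
      ((hA u hu).2.trans (hA w hw).2.symm) hz hz'

lemma exists_child_of_root (hr : ∀ v, ∃ k, s^[k] v = 0) {z : Fin (n + 1)} (hz : z ≠ 0) :
    ∃ u, (u ≠ 0 ∧ s u = 0) ∧ ∃ k, s^[k] z = u := by
  obtain ⟨k, hk⟩ := hr z
  induction k generalizing z with
  | zero => exact absurd hk hz
  | succ k ih =>
    by_cases h : s z = 0
    · exact ⟨z, ⟨hz, h⟩, 0, rfl⟩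
    · obtain ⟨u, hu, j, hj⟩ := ih h hk
      exact ⟨u, hu, j + 1, hj⟩

lemma exists_large_child_of_root (hn : 0 < n) (hr : ∀ v, ∃ k, s^[k] v = 0) :
    ∃ u, (u ≠ 0 ∧ s u = 0) ∧ n ≤ indeg 0 s 0 * subtreeSize s u := by
  set A : Finset (Fin (n + 1)) := Finset.univ.filter fun u => u ≠ 0 ∧ s u = 0 with hA
  have hcov : Finset.univ.erase (0 : Fin (n + 1)) ⊆
      A.biUnion fun u => Finset.univ.filter fun w => ∃ k, s^[k] w = u := by
    intro z hz
    obtain ⟨u, hu, hzu⟩ := exists_child_of_root hr (Finset.ne_of_mem_erase hz)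
    simp only [Finset.mem_biUnion, Finset.mem_filter, Finset.mem_univ, true_and, hA]
    exact ⟨u, hu, hzu⟩
  have hsum : n ≤ ∑ u ∈ A, subtreeSize s u := by
    simp only [subtreeSize_eq_card]
    refine le_trans ?_ ((Finset.card_le_card hcov).trans Finset.card_biUnion_le)
    rw [Finset.card_erase_of_mem (Finset.mem_univ _)]
    simp
  have hne : A.Nonempty := by
    rw [Finset.nonempty_iff_ne_empty]
    rintro h
    rw [h, Finset.sum_empty] at hsum
    omega
  obtain ⟨u, hu, hmax⟩ := A.exists_max_image (subtreeSize s) hne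
  refine ⟨u, by simpa [hA] using hu, hsum.trans ?_⟩
  rw [indeg_eq_card, ← smul_eq_mul]
  exact Finset.sum_le_card_nsmul _ _ _ hmax

lemma one_le_indeg {v : Fin (n + 1)} (hv : v ≠ 0) : 1 ≤ indeg 0 s (s v) := by
  rw [indeg_eq_card]
  exact Finset.card_pos.2 ⟨v, by simp [hv]⟩

lemma exists_one_le_cost (hn : 0 < n) (h0 : s 0 = 0) (hr : ∀ v, ∃ k, s^[k] v = 0) :
    ∃ v, v ≠ 0 ∧ 1 ≤ cost 0 s v := by
  obtain ⟨c, ⟨hc, hsc⟩, -⟩ := exists_large_child_of_root hn hr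
  have hns : ¬ Surjective s := fun h => hc (Finite.injective_iff_surjective.2 h (hsc.trans h0.symm))
  obtain ⟨v, hv⟩ := not_forall.1 hns
  have hv0 : v ≠ 0 := fun h => hv ⟨0, h0.trans h.symm⟩
  have hsize : subtreeSize s v = 1 := by
    rw [subtreeSize_eq_card, Finset.card_eq_one]
    refine ⟨v, ?_⟩
    ext z
    simp only [Finset.mem_filter, Finset.mem_univ, true_and, Finset.mem_singleton]
    constructor
    · rintro ⟨k, hk⟩
      cases k with
      | zero => exact hk
      | succ k => exact absurd ⟨_, (iterate_succ_apply' s k z).symm.trans hk⟩ hv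
    · rintro rfl
      exact ⟨0, rfl⟩
  refine ⟨v, hv0, ?_⟩
  rw [cost_eq_add hv0 (hr _), hsize]
  have h1 : (1 : ℝ≥0∞) ≤ (indeg 0 s (s v) : ℝ≥0∞) := by exact_mod_cast one_le_indeg hv0
  simpa using le_add_right h1

end Tree

section Deviation

variable {u w : Fin (n + 1)}

lemma reach_update_or {z x : Fin (n + 1)} (h : ∃ k, s^[k] z = x) :
    (∃ k, (update s u w)^[k] z = x) ∨ ∃ k, (update s u w)^[k] z = u := by
  obtain ⟨k, hk⟩ := h
  induction k generalizing z with
  | zero => exact Or.inl ⟨0, hk⟩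
  | succ k ih =>
    by_cases hz : z = u
    · exact Or.inr ⟨0, hz⟩
    · have hs : update s u w z = s z := update_of_ne hz _ _
      rcases ih hk with ⟨j, hj⟩ | ⟨j, hj⟩
      · exact Or.inl ⟨j + 1, by rwa [iterate_succ_apply, hs]⟩
      · exact Or.inr ⟨j + 1, by rwa [iterate_succ_apply, hs]⟩

lemma reach_trans {z x y : Fin (n + 1)} (h : ∃ k, s^[k] z = x) (h' : ∃ k, s^[k] x = y) :
    ∃ k, s^[k] z = y := by
  obtain ⟨a, rfl⟩ := h
  obtain ⟨b, rfl⟩ := h'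
  exact ⟨b + a, iterate_add_apply s b a z⟩

lemma subtreeSize_mono {s' : Fin (n + 1) → Fin (n + 1)} {x : Fin (n + 1)}
    (h : ∀ z, (∃ k, s^[k] z = x) → ∃ k, s'^[k] z = x) : subtreeSize s x ≤ subtreeSize s' x := by
  simp only [subtreeSize_eq_card]
  exact Finset.card_le_card (Finset.monotone_filter_right _ fun z _ => h z)

lemma indeg_update_le_of_ne {x : Fin (n + 1)} (hx : x ≠ w) :
    indeg 0 (update s u w) x ≤ indeg 0 s x := by
  simp only [indeg_eq_card]
  refine Finset.card_le_card (Finset.monotone_filter_right _ fun z _ hz => ⟨hz.1, ?_⟩)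
  by_cases h : z = u
  · subst h
    simp only [update_self] at hz
    exact absurd hz.2.symm hx
  · simpa [update_of_ne h] using hz.2

lemma indeg_update_parent_add_one_le (hu : u ≠ 0) (hw : s u ≠ w) :
    indeg 0 (update s u w) (s u) + 1 ≤ indeg 0 s (s u) := by
  simp only [indeg_eq_card]
  refine Finset.card_lt_card (Finset.ssubset_iff_of_subset ?_ |>.2 ⟨u, by simp [hu], ?_⟩)
  · refine Finset.monotone_filter_right _ fun z _ hz => ⟨hz.1, ?_⟩
    by_cases h : z = u
    · rw [h]
    · simpa [update_of_ne h] using hz.2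
  · simpa using fun _ => hw.symm

lemma indeg_update_target_le : indeg 0 (update s u w) w ≤ indeg 0 s w + 1 := by
  simp only [indeg_eq_card]
  refine le_trans (Finset.card_le_card fun z hz => ?_) (Finset.card_insert_le u _)
  simp only [Finset.mem_filter, Finset.mem_univ, true_and, Finset.mem_insert] at hz ⊢
  by_cases h : z = u
  · exact Or.inl h
  · exact Or.inr ⟨hz.1, by simpa [update_of_ne h] using hz.2⟩

variable (h0 : s 0 = 0) (hr : ∀ v, ∃ k, s^[k] v = 0) (hu : u ≠ 0) (hw : w ≠ 0) (huw : w ≠ u)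
  (hs : s u = s w)
include h0 hr hu hw huw hs

lemma cost_update_ancestor_le {x : Fin (n + 1)} (hx : ∃ j, s^[j] (s u) = x) :
    cost 0 (update s u w) x ≤ cost 0 s x ∧ ∃ k, (update s u w)^[k] x = 0 := by
  obtain ⟨k, hk⟩ := hr x
  induction k generalizing x with
  | zero =>
    rw [show x = 0 from hk]
    exact ⟨by rw [cost_zero, cost_zero], 0, rfl⟩
  | succ k ih =>
    by_cases hx0 : x = 0
    · rw [hx0]
      exact ⟨by rw [cost_zero, cost_zero], 0, rfl⟩
    have hxu : x ≠ u := by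
      rintro rfl
      obtain ⟨j, hj⟩ := hx
      exact hu (eq_zero_of_cycle h0 hr hj)
    have hsx : update s u w x = s x := update_of_ne hxu _ _
    have hup : ∃ j, s^[j] (s u) = s x := reach_trans hx ⟨1, rfl⟩
    obtain ⟨hle, hreach⟩ := ih hup hk
    have hsxw : s x ≠ w := by
      rintro h
      obtain ⟨j, hj⟩ := hup
      rw [h, hs] at hj
      exact hw (eq_zero_of_cycle h0 hr hj)
    have hsize : subtreeSize s x ≤ subtreeSize (update s u w) x := by
      refine subtreeSize_mono fun z hz => ?_
      rcases reach_update_or (u := u) (w := w) hz with h | h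
      · exact h
      · have hvx : ∃ j, (update s u w)^[j] (s u) = x := by
          obtain ⟨j, hj⟩ := hx
          refine ⟨j, ?_⟩
          have key : ∀ i, (update s u w)^[i] (s u) = s^[i] (s u) := by
            intro i
            induction i with
            | zero => rfl
            | succ i ih =>
              rw [iterate_succ_apply', iterate_succ_apply', ih, update_of_ne]
              exact fun h => hu (eq_zero_of_cycle h0 hr h)
          rw [key, hj]
        refine reach_trans h (reach_trans (x := s u) ⟨2, ?_⟩ hvx)
        simp [update_of_ne huw, hs]
    rw [← hsx] at hreach hle hsxw
    refine ⟨?_, ?_⟩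
    · rw [cost_eq_add hx0 (hr _), cost_eq_add hx0 hreach]
      refine add_le_add (ENNReal.div_le_div ?_ (by exact_mod_cast hsize)) ?_
      · have := indeg_update_le_of_ne (s := s) (u := u) hsxw
        rw [hsx] at this ⊢
        exact_mod_cast this
      · rwa [hsx] at hle ⊢
    · obtain ⟨j, hj⟩ := hreach
      exact ⟨j + 1, hj⟩

lemma subtreeSize_add_le_update :
    subtreeSize s w + subtreeSize s u ≤ subtreeSize (update s u w) w := by
  have hd : Disjoint (Finset.univ.filter fun z => ∃ k, s^[k] z = w)
      (Finset.univ.filter fun z => ∃ k, s^[k] z = u) := by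
    refine Finset.disjoint_left.2 fun z hz hz' => ?_
    simp only [Finset.mem_filter, Finset.mem_univ, true_and] at hz hz'
    exact siblings_not_both_reached h0 hr hu hw huw.symm hs hz' hz
  simp only [subtreeSize_eq_card]
  rw [← Finset.card_union_of_disjoint hd]
  refine Finset.card_le_card fun z hz => ?_
  simp only [Finset.mem_union, Finset.mem_filter, Finset.mem_univ, true_and] at hz ⊢
  have huw' : ∃ k, (update s u w)^[k] u = w := ⟨1, by simp⟩
  rcases hz with hz | hz <;> rcases reach_update_or (u := u) (w := w) hz with h | h
  · exact h
  · exact reach_trans h huw'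
  · exact reach_trans h huw'
  · exact reach_trans h huw'

lemma cost_update_sibling_le :
    cost 0 (update s u w) u ≤ ((indeg 0 s w + 1 : ℕ) : ℝ≥0∞) / (subtreeSize s u : ℝ≥0∞) +
      (((indeg 0 s (s u) - 1 : ℕ) : ℝ≥0∞) /
        ((subtreeSize s w + subtreeSize s u : ℕ) : ℝ≥0∞) + cost 0 s (s u)) := by
  obtain ⟨hle, hreach⟩ := cost_update_ancestor_le h0 hr hu hw huw hs ⟨0, rfl⟩
  have hsw : update s u w w = s u := by rw [update_of_ne huw, hs]
  have hsu : update s u w u = w := update_self _ _ _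
  have hreach' : ∃ k, (update s u w)^[k] (update s u w w) = 0 := by rwa [hsw]
  have hreachu : ∃ k, (update s u w)^[k] (update s u w u) = 0 := by
    rw [hsu]
    obtain ⟨k, hk⟩ := hreach'
    exact ⟨k + 1, hk⟩
  rw [cost_eq_add hu hreachu, hsu, cost_eq_add hw hreach', hsw]
  refine add_le_add (ENNReal.div_le_div ?_ ?_) (add_le_add (ENNReal.div_le_div ?_ ?_) hle)
  · exact_mod_cast indeg_update_target_le
  · refine Nat.cast_le.2 (subtreeSize_mono fun z hz => ?_)
    rcases reach_update_or (u := u) (w := w) hz with h | h <;> exact h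
  · have hsuw : s u ≠ w := fun h => hw (eq_zero_of_cycle (j := 0) h0 hr (hs ▸ h))
    exact Nat.cast_le.2 (Nat.le_sub_one_of_lt (indeg_update_parent_add_one_le hu hsuw))
  · exact Nat.cast_le.2 (subtreeSize_add_le_update h0 hr hu hw huw hs)

/-- In a stable tree, a node that is not the smallest among its siblings has in-degree at least
half of (its parent's in-degree minus one). -/
lemma IsStable.indeg_parent_add_one_le (hst : IsStable 0 s)
    (hsize : subtreeSize s u ≤ subtreeSize s w) :
    indeg 0 s (s u) + 1 ≤ 2 * (indeg 0 s w + 1) := by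
  have h := (hst.2 u hu w huw).trans (cost_update_sibling_le h0 hr hu hw huw hs)
  rw [cost_eq_add hu (hr _), ← add_assoc, ENNReal.add_le_add_iff_right (cost_ne_top (hr _))] at h
  have hpos := subtreeSize_pos s u
  have hd : 1 ≤ indeg 0 s (s u) := one_le_indeg hu
  have hpos' : (0 : ℝ) < subtreeSize s u := by exact_mod_cast hpos
  have hsize' : (subtreeSize s u : ℝ) ≤ subtreeSize s w := by exact_mod_cast hsize
  have hR : (indeg 0 s (s u) : ℝ) / subtreeSize s u ≤ ((indeg 0 s w : ℝ) + 1) / subtreeSize s u +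
      ((indeg 0 s (s u) : ℝ) - 1) / (subtreeSize s w + subtreeSize s u) := by
    have h1 : ((subtreeSize s u : ℕ) : ℝ≥0∞) ≠ 0 := by exact_mod_cast hpos.ne'
    have h2 : ((subtreeSize s w + subtreeSize s u : ℕ) : ℝ≥0∞) ≠ 0 := by
      exact_mod_cast (by omega : subtreeSize s w + subtreeSize s u ≠ 0)
    have hf1 := (ENNReal.div_lt_top (ENNReal.natCast_ne_top (indeg 0 s w + 1)) h1).ne
    have hf2 := (ENNReal.div_lt_top (ENNReal.natCast_ne_top (indeg 0 s (s u) - 1)) h2).ne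
    have := ENNReal.toReal_mono (ENNReal.add_ne_top.2 ⟨hf1, hf2⟩) h
    rw [ENNReal.toReal_add hf1 hf2] at this
    simp only [ENNReal.toReal_div, ENNReal.toReal_natCast] at this
    simpa only [Nat.cast_sub hd, Nat.cast_add, Nat.cast_one] using this
  have hd' : (0 : ℝ) ≤ (indeg 0 s (s u) : ℝ) - 1 := by
    have : (1 : ℝ) ≤ indeg 0 s (s u) := by exact_mod_cast hd
    linarith
  have hhalf : ((indeg 0 s (s u) : ℝ) - 1) / (subtreeSize s w + subtreeSize s u) ≤
      ((indeg 0 s (s u) : ℝ) - 1) / 2 / subtreeSize s u := by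
    rw [div_div]
    exact div_le_div_of_nonneg_left hd' (by linarith) (by linarith)
  have hR' := hR.trans (add_le_add le_rfl hhalf)
  rw [← add_div, div_le_div_iff_of_pos_right hpos'] at hR'
  have : (indeg 0 s (s u) : ℝ) + 1 ≤ 2 * ((indeg 0 s w : ℝ) + 1) := by linarith
  exact_mod_cast this

end Deviation

lemma growth_step {L : ℝ} (hL : 4 ≤ L) :
    (2 : ℝ) ^ (L ^ 2 / 2 + L / 4 - 9) ≤
      (2 ^ L - 2) * (2 : ℝ) ^ ((L - 1) ^ 2 / 2 + (L - 1) / 4 - 9) := by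
  have hsplit : (2 : ℝ) ^ (L ^ 2 / 2 + L / 4 - 9) =
      2 ^ L * 2 ^ (-(1 / 4) : ℝ) * 2 ^ ((L - 1) ^ 2 / 2 + (L - 1) / 4 - 9) := by
    rw [← Real.rpow_add two_pos, ← Real.rpow_add two_pos]
    congr 1
    ring
  have hq : (2 : ℝ) ^ (-(1 / 4) : ℝ) ≤ 7 / 8 := by
    refine le_of_pow_le_pow_left₀ (n := 4) (by norm_num) (by norm_num) ?_
    rw [← Real.rpow_natCast, ← Real.rpow_mul two_pos.le]
    norm_num [Real.rpow_neg_one]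
  have h16 : (16 : ℝ) ≤ 2 ^ L :=
    calc (16 : ℝ) = 2 ^ (4 : ℝ) := by norm_num
      _ ≤ 2 ^ L := Real.rpow_le_rpow_of_exponent_le one_le_two hL
  rw [hsplit]
  gcongr
  nlinarith

/-- In a stable tree, subtree sizes grow superpolynomially in the in-degree of their root. -/
lemma IsStable.rpow_le_subtreeSize (hst : IsStable 0 s) (hr : ∀ v, ∃ k, s^[k] v = 0)
    {L : ℝ} (hL : 0 ≤ L) {v : Fin (n + 1)} (hv : (2 : ℝ) ^ L ≤ indeg 0 s v + 1) :
    (2 : ℝ) ^ (L ^ 2 / 2 + L / 4 - 9) ≤ subtreeSize s v := by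
  obtain ⟨m, hm⟩ := exists_nat_ge (L - 4)
  induction m generalizing L v with
  | zero =>
    have hle : L ^ 2 / 2 + L / 4 - 9 ≤ 0 := by
      norm_num at hm
      nlinarith
    calc (2 : ℝ) ^ (L ^ 2 / 2 + L / 4 - 9) ≤ 1 :=
          Real.rpow_le_one_of_one_le_of_nonpos one_le_two hle
      _ ≤ subtreeSize s v := by exact_mod_cast subtreeSize_pos s v
  | succ m ih =>
    by_cases h4 : L ≤ 4
    · exact ih hL hv (by have : (0 : ℝ) ≤ m := m.cast_nonneg; linarith)
    push Not at h4
    have h0 : s 0 = 0 := hst.1.1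
    have h16 : (16 : ℝ) ≤ 2 ^ L :=
      calc (16 : ℝ) = 2 ^ (4 : ℝ) := by norm_num
        _ ≤ 2 ^ L := Real.rpow_le_rpow_of_exponent_le one_le_two h4.le
    set A : Finset (Fin (n + 1)) := Finset.univ.filter fun u => u ≠ 0 ∧ s u = v with hA
    have hcard : indeg 0 s v = A.card := indeg_eq_card s v
    have hne : A.Nonempty := by
      rw [← Finset.card_pos, ← hcard]
      have : (0 : ℝ) < indeg 0 s v := by linarith
      exact_mod_cast this
    obtain ⟨u, hu, hmin⟩ := A.exists_min_image (subtreeSize s) hne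
    have hmem : ∀ x ∈ A, x ≠ 0 ∧ s x = v := fun x hx => by simpa [hA] using hx
    have hchild : ∀ w ∈ A.erase u,
        (2 : ℝ) ^ ((L - 1) ^ 2 / 2 + (L - 1) / 4 - 9) ≤ subtreeSize s w := by
      intro w hw
      have hwA := Finset.mem_of_mem_erase hw
      refine ih (by linarith) ?_ (by push_cast at hm; linarith)
      have hhalf := hst.indeg_parent_add_one_le h0 hr (hmem u hu).1 (hmem w hwA).1
        (Finset.ne_of_mem_erase hw) ((hmem u hu).2.trans (hmem w hwA).2.symm) (hmin w hwA)
      rw [(hmem u hu).2] at hhalf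
      have hhalf' : (indeg 0 s v : ℝ) + 1 ≤ 2 * (indeg 0 s w + 1) := by exact_mod_cast hhalf
      rw [Real.rpow_sub_one two_ne_zero]
      linarith
    have hsum : ((∑ w ∈ A.erase u, subtreeSize s w : ℕ) : ℝ) ≤ subtreeSize s v :=
      Nat.cast_le.2 (sum_subtreeSize_le h0 hr v _ fun w hw => hmem w (Finset.mem_of_mem_erase hw))
    have hlow := Finset.card_nsmul_le_sum _ _ _ hchild
    have herase : ((A.erase u).card : ℝ) = indeg 0 s v - 1 := by
      rw [hcard, Finset.card_erase_of_mem hu, Nat.cast_sub (Finset.card_pos.2 hne), Nat.cast_one]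
    rw [nsmul_eq_mul, herase] at hlow
    push_cast at hsum
    refine (growth_step h4.le).trans (le_trans ?_ (hlow.trans hsum))
    exact mul_le_mul_of_nonneg_right (by linarith) (by positivity)

lemma IsStable.indeg_root_le (hst : IsStable 0 s) (hr : ∀ v, ∃ k, s^[k] v = 0)
    (hn : 2 ^ 800 ≤ n) :
    (indeg 0 s 0 : ℝ) ≤ 2 ^ √(2 * Real.logb 2 n) := by
  have hn1 : (1 : ℝ) ≤ n := by exact_mod_cast Nat.one_le_two_pow.trans hn
  have hlog : 800 ≤ Real.logb 2 n := by
    rw [Real.le_logb_iff_rpow_le one_lt_two (by linarith)]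
    exact_mod_cast hn
  set d : ℝ := (indeg 0 s 0 : ℝ)
  have hd0 : 0 ≤ d := Nat.cast_nonneg _
  set L : ℝ := Real.logb 2 (d + 1) with hLdef
  have hL0 : 0 ≤ L := Real.logb_nonneg one_lt_two (by linarith)
  have hpow : (2 : ℝ) ^ L = d + 1 := Real.rpow_logb two_pos (by norm_num) (by linarith)
  have hLs : L ≤ √(2 * Real.logb 2 n) := by
    apply Real.le_sqrt_of_sq_le
    rcases le_total L 40 with h | h
    · nlinarith
    · have hsize := hst.rpow_le_subtreeSize hr hL0 hpow.le
      have hcard : subtreeSize s 0 ≤ n + 1 := by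
        rw [subtreeSize_eq_card]
        simpa using Finset.card_le_univ (Finset.univ.filter fun w => ∃ k, s^[k] w = 0)
      have hcard' : (subtreeSize s 0 : ℝ) ≤ n + 1 := by exact_mod_cast hcard
      have hexp : (2 : ℝ) ^ (L ^ 2 / 2 + 1) ≤ 2 ^ (L ^ 2 / 2 + L / 4 - 9) :=
        Real.rpow_le_rpow_of_exponent_le one_le_two (by linarith)
      rw [Real.rpow_add_one two_ne_zero] at hexp
      have : L ^ 2 / 2 ≤ Real.logb 2 n := by
        rw [Real.le_logb_iff_rpow_le one_lt_two (by linarith)]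
        linarith
      linarith
  calc d ≤ 2 ^ L := by linarith
    _ ≤ 2 ^ √(2 * Real.logb 2 n) := Real.rpow_le_rpow_of_exponent_le one_le_two hLs

/-- For all sufficiently large `n` and every stable tree with `n`
agents, the Fairness Ratio is at least `n · 2^{−2·√(2·log₂ n)}`. -/
theorem fairness_ratio_lower_bound :
    ∃ N : ℕ, ∀ n : ℕ, N ≤ n →
      ∀ s : Fin (n + 1) → Fin (n + 1),
        IsStable 0 s → (∀ v, ∃ k, s^[k] v = 0) →
        ENNReal.ofReal ((n : ℝ) *
            (2 : ℝ) ^ (-(2 : ℝ) * Real.sqrt (2 * Real.logb 2 (n : ℝ)))) ≤ FR s := by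
  refine ⟨2 ^ 800, fun n hn s hst hr => ?_⟩
  have h0 : s 0 = 0 := hst.1.1
  have hn0 : 0 < n := lt_of_lt_of_le (by positivity) hn
  obtain ⟨v, hv, hcv⟩ := exists_one_le_cost hn0 h0 hr
  obtain ⟨u, ⟨hu, hsu⟩, hsize⟩ := exists_large_child_of_root hn0 hr
  have hd := hst.indeg_root_le hr hn
  have hcu : cost 0 s u = (indeg 0 s 0 : ℝ≥0∞) / (subtreeSize s u : ℝ≥0∞) := by
    rw [cost_eq_add hu (hr _), hsu, cost_zero, add_zero]
  have hpos : (0 : ℝ) < subtreeSize s u := by exact_mod_cast subtreeSize_pos s u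
  have hd1 : 1 ≤ indeg 0 s 0 := hsu ▸ one_le_indeg hu
  have hdpos : (0 : ℝ) < indeg 0 s 0 := by exact_mod_cast hd1
  have hratio : ENNReal.ofReal ((subtreeSize s u : ℝ) / indeg 0 s 0) = 1 / cost 0 s u := by
    rw [hcu, one_div, ENNReal.inv_div (Or.inl (ENNReal.natCast_ne_top _))
      (Or.inl (by exact_mod_cast (subtreeSize_pos s u).ne')), ENNReal.ofReal_div_of_pos hdpos,
      ENNReal.ofReal_natCast, ENNReal.ofReal_natCast]
  have hreal : (n : ℝ) * (2 : ℝ) ^ (-(2 : ℝ) * √(2 * Real.logb 2 (n : ℝ))) ≤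
      (subtreeSize s u : ℝ) / indeg 0 s 0 := by
    set t : ℝ := √(2 * Real.logb 2 (n : ℝ))
    have hsize' : (n : ℝ) ≤ indeg 0 s 0 * subtreeSize s u := by exact_mod_cast hsize
    have htpos : (0 : ℝ) < 2 ^ t := Real.rpow_pos_of_pos two_pos t
    rw [show -(2 : ℝ) * t = -(t + t) by ring, Real.rpow_neg two_pos.le, Real.rpow_add two_pos,
      ← div_eq_mul_inv, div_le_div_iff₀ (mul_pos htpos htpos) hdpos]
    calc (n : ℝ) * indeg 0 s 0 ≤ indeg 0 s 0 * subtreeSize s u * indeg 0 s 0 := by gcongr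
      _ = subtreeSize s u * (indeg 0 s 0 * indeg 0 s 0) := by ring
      _ ≤ subtreeSize s u * (2 ^ t * 2 ^ t) := by gcongr
  refine (ENNReal.ofReal_le_ofReal hreal).trans ?_
  rw [hratio, FR]
  exact ENNReal.div_le_div (hcv.trans (le_iSup₂_of_le v hv le_rfl)) (iInf₂_le u hu)

end TCG
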